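/- Let m ∈ ℝ and let φ : ℝⁿ → ℝ be a C^∞ function satisfying the flat Klein–Gordon equation η^{μν} ∂_μ∂_ν φ = m²·φ everywhere. Then the super-energy tensor field of the massive scalar field φ is divergence-free: η^{ρα} ∂_ρ 𝒮_{αβλμ} = 0 at every point, for all β, λ, μ. -/

import Mathlib

open Finset

noncomputable section

/-- Components of the Minkowski metric (and of its inverse) in dimension `n`. -/
def gmet (n : ℕ) (μ ν : Fin n) : ℝ :=
  if μ = ν then (if (μ : ℕ) = 0 then -1 else 1) else 0

/-- The partial derivative `∂_μ f` of a scalar field on flat spacetime `ℝⁿ`. -/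
def pd (n : ℕ) (μ : Fin n) (f : (Fin n → ℝ) → ℝ) : (Fin n → ℝ) → ℝ :=
  fun x => fderiv ℝ f x (Pi.single μ 1)

/-- The super-energy tensor field `𝒮_{αβλμ}` of a massive scalar field `φ` on flat
spacetime. -/
def seSm (n : ℕ) (m : ℝ) (φ : (Fin n → ℝ) → ℝ) (α β lam mu : Fin n) (x : Fin n → ℝ) : ℝ :=
  pd n α (pd n lam φ) x * pd n mu (pd n β φ) x
    + pd n α (pd n mu φ) x * pd n lam (pd n β φ) x
    - gmet n α β *
        ((∑ ρ : Fin n, ∑ σ : Fin n,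
            gmet n ρ σ * pd n lam (pd n ρ φ) x * pd n mu (pd n σ φ) x)
          + m ^ 2 * pd n lam φ x * pd n mu φ x)
    - gmet n lam mu *
        ((∑ ρ : Fin n, ∑ σ : Fin n,
            gmet n ρ σ * pd n α (pd n ρ φ) x * pd n β (pd n σ φ) x)
          + m ^ 2 * pd n α φ x * pd n β φ x)
    + (1 / 2) * gmet n α β * gmet n lam mu *
        ((∑ ρ : Fin n, ∑ τ : Fin n, ∑ σ : Fin n, ∑ ν : Fin n,
            gmet n ρ τ * gmet n σ ν * pd n ρ (pd n σ φ) x * pd n τ (pd n ν φ) x)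
          + 2 * m ^ 2 * (∑ ρ : Fin n, ∑ σ : Fin n, gmet n ρ σ * pd n ρ φ x * pd n σ φ x)
          + m ^ 4 * (φ x) ^ 2)

/-- Diagonal entries of the Minkowski metric. -/
def eps (n : ℕ) (μ : Fin n) : ℝ := if (μ : ℕ) = 0 then -1 else 1

lemma gmet_eq (n : ℕ) (μ ν : Fin n) : gmet n μ ν = if μ = ν then eps n μ else 0 := rfl

lemma eps_sq (n : ℕ) (μ : Fin n) : eps n μ * eps n μ = 1 := by
  unfold eps; split_ifs <;> norm_num

lemma pd_smooth {n : ℕ} {f : (Fin n → ℝ) → ℝ} (hf : ContDiff ℝ (⊤ : ℕ∞) f) (μ : Fin n) :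
    ContDiff ℝ (⊤ : ℕ∞) (pd n μ f) := by
  unfold pd
  exact (hf.fderiv_right (m := (⊤ : ℕ∞)) (by simp)).clm_apply contDiff_const

lemma pd_comm {n : ℕ} {f : (Fin n → ℝ) → ℝ} (hf : ContDiff ℝ (⊤ : ℕ∞) f) (μ ν : Fin n) :
    pd n μ (pd n ν f) = pd n ν (pd n μ f) := by
  funext x
  have hd : DifferentiableAt ℝ (fderiv ℝ f) x :=
    ((hf.fderiv_right (m := (⊤ : ℕ∞)) (by simp)).differentiable (by simp)) x
  have hs : IsSymmSndFDerivAt ℝ f x := hf.contDiffAt.isSymmSndFDerivAt (by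
    simp only [minSmoothness_of_isRCLikeNormedField]; exact WithTop.coe_le_coe.mpr (le_top : (2 : ℕ∞) ≤ ⊤))
  have key : ∀ a b : Fin n, pd n a (pd n b f) x
      = fderiv ℝ (fderiv ℝ f) x (Pi.single a 1) (Pi.single b 1) := by
    intro a b
    unfold pd
    rw [fderiv_clm_apply hd (differentiableAt_const _)]
    simp
  rw [key, key]
  exact hs _ _

lemma pd_add' {n : ℕ} {f g : (Fin n → ℝ) → ℝ} (hf : Differentiable ℝ f)
    (hg : Differentiable ℝ g) (μ : Fin n) (x : Fin n → ℝ) :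
    pd n μ (fun y => f y + g y) x = pd n μ f x + pd n μ g x := by
  unfold pd
  rw [fderiv_fun_add (hf x) (hg x)]; rfl

lemma pd_sub' {n : ℕ} {f g : (Fin n → ℝ) → ℝ} (hf : Differentiable ℝ f)
    (hg : Differentiable ℝ g) (μ : Fin n) (x : Fin n → ℝ) :
    pd n μ (fun y => f y - g y) x = pd n μ f x - pd n μ g x := by
  unfold pd
  rw [fderiv_fun_sub (hf x) (hg x)]; rfl

lemma pd_mul' {n : ℕ} {f g : (Fin n → ℝ) → ℝ} (hf : Differentiable ℝ f)
    (hg : Differentiable ℝ g) (μ : Fin n) (x : Fin n → ℝ) :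
    pd n μ (fun y => f y * g y) x = pd n μ f x * g x + f x * pd n μ g x := by
  unfold pd
  rw [fderiv_fun_mul (hf x) (hg x)]
  simp; ring

lemma pd_cmul {n : ℕ} {f : (Fin n → ℝ) → ℝ} (hf : Differentiable ℝ f) (c : ℝ)
    (μ : Fin n) (x : Fin n → ℝ) :
    pd n μ (fun y => c * f y) x = c * pd n μ f x := by
  unfold pd
  rw [fderiv_const_mul (hf x)]; rfl

lemma pd_sum' {n : ℕ} {f : Fin n → (Fin n → ℝ) → ℝ} (hf : ∀ i, Differentiable ℝ (f i))
    (μ : Fin n) (x : Fin n → ℝ) :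
    pd n μ (fun y => ∑ i, f i y) x = ∑ i, pd n μ (f i) x := by
  unfold pd
  rw [fderiv_fun_sum (fun i _ => hf i x)]; simp

/-- The algebraic identity behind the divergence computation. -/
lemma div_algebra {n : ℕ} (e P : Fin n → ℝ) (H : Fin n → Fin n → ℝ)
    (T : Fin n → Fin n → Fin n → ℝ) (M p g : ℝ) (he : ∀ a, e a * e a = 1)
    (hH : ∀ a b, H a b = H b a) (hT1 : ∀ a b c, T a b c = T b a c)
    (hT2 : ∀ a b c, T a b c = T a c b)
    (K1 : ∑ a, e a * H a a = M * p) (K2 : ∀ c, ∑ a, e a * T c a a = M * P c)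
    (b l k : Fin n) :
    ∑ a, e a * (T a a l * H k b + H a l * T a k b + (T a a k * H l b + H a k * T a l b)
      - (if a = b then e a else 0) *
        ((∑ r, e r * (T a l r * H k r + H l r * T a k r)) + M * (H a l * P k + P l * H a k))
      - g * ((∑ r, e r * (T a a r * H b r + H a r * T a b r)) + M * (H a a * P b + P a * H a b))
      + (1 / 2) * (if a = b then e a else 0) * g *
        ((∑ r, ∑ s, e r * e s * (2 * (H r s * T a r s))) + 2 * M * (∑ r, e r * (2 * (P r * H a r)))
          + M ^ 2 * (2 * (p * P a)))) = 0 := by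
  have K2' : ∀ c, ∑ a, e a * T a a c = M * P c := by
    intro c
    rw [← K2 c]
    refine Finset.sum_congr rfl fun a _ => ?_
    rw [hT2 a a c, hT1 a c a]
  have hdelta : ∀ F : Fin n → ℝ, ∑ a, e a * ((if a = b then e a else 0) * F a) = F b := by
    intro F
    simp [← mul_assoc, he]
  have h1 : ∀ c d, ∑ a, e a * (T a a c * d) = M * P c * d := by
    intro c d
    rw [← K2' c, Finset.sum_mul]
    exact Finset.sum_congr rfl fun a _ => by ring
  have h4 : ∑ a, e a * (∑ r, e r * (T a a r * H b r + H a r * T a b r))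
      = M * (∑ r, e r * (P r * H b r)) + ∑ r, ∑ s, e r * e s * (H r s * T b r s) := by
    have : ∀ a, e a * (∑ r, e r * (T a a r * H b r + H a r * T a b r))
        = ∑ r, e r * (e a * (T a a r * H b r)) + ∑ r, e a * e r * (H a r * T b a r) := by
      intro a
      rw [Finset.mul_sum, ← Finset.sum_add_distrib]
      refine Finset.sum_congr rfl fun r _ => ?_
      rw [hT1 a b r]; ring
    simp_rw [this]
    rw [Finset.sum_add_distrib, Finset.sum_comm]
    simp_rw [← Finset.mul_sum, h1]
    congr 1
    · rw [Finset.mul_sum]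
      exact Finset.sum_congr rfl fun a _ => by ring
  set A : Fin n → ℝ := fun a => 
        ((∑ r, e r * (T a l r * H k r + H l r * T a k r)) + M * (H a l * P k + P l * H a k)) with hA
  set B : Fin n → ℝ := fun a => 
        ((∑ r, ∑ s, e r * e s * (2 * (H r s * T a r s))) + 2 * M * (∑ r, e r * (2 * (P r * H a r)))
          + M ^ 2 * (2 * (p * P a))) with hB
  have split : ∀ a, e a * (T a a l * H k b + H a l * T a k b + (T a a k * H l b + H a k * T a l b)
      - (if a = b then e a else 0) * A a
      - g * ((∑ r, e r * (T a a r * H b r + H a r * T a b r)) + M * (H a a * P b + P a * H a b))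
      + (1 / 2) * (if a = b then e a else 0) * g * B a)
      = e a * (T a a l * H k b) + e a * (T a a k * H l b)
        + e a * (T b l a * H k a + H l a * T b k a)
        - e a * ((if a = b then e a else 0) * A a)
        - g * (e a * (∑ r, e r * (T a a r * H b r + H a r * T a b r)))
        - g * M * P b * (e a * H a a) - g * M * (e a * (P a * H b a))
        + (1 / 2) * g * (e a * ((if a = b then e a else 0) * B a)) := by
    intro a
    have q1 : T b k a = T a k b := by rw [hT2 b k a, hT1 b a k, hT2 a b k]
    have q2 : T b l a = T a l b := by rw [hT2 b l a, hT1 b a l, hT2 a b l]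
    rw [q1, q2, hH a l, hH a k, hH b a]
    ring
  rw [Finset.sum_congr rfl fun a _ => split a]
  simp only [Finset.sum_add_distrib, Finset.sum_sub_distrib, ← Finset.mul_sum, hdelta, h1, h4, K1]
  simp only [hA, hB]
  have f1 : ∑ r, ∑ s, e r * e s * (2 * (H r s * T b r s))
      = 2 * ∑ r, ∑ s, e r * e s * (H r s * T b r s) := by
    simp_rw [Finset.mul_sum]
    exact Finset.sum_congr rfl fun a _ => Finset.sum_congr rfl fun c _ => by ring
  have f2 : ∑ r, e r * (2 * (P r * H b r)) = 2 * ∑ r, e r * (P r * H b r) := by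
    rw [Finset.mul_sum]
    exact Finset.sum_congr rfl fun a _ => by ring
  rw [f1, f2, hH k b, hH l b]
  ring

/-- The super-energy tensor with the metric contractions carried out. -/
lemma seSm_eq (n : ℕ) (m : ℝ) (φ : (Fin n → ℝ) → ℝ) (a b l k : Fin n) :
    seSm n m φ a b l k = fun x =>
      pd n a (pd n l φ) x * pd n k (pd n b φ) x + pd n a (pd n k φ) x * pd n l (pd n b φ) x
      - (if a = b then eps n a else 0) *
        ((∑ r, eps n r * (pd n l (pd n r φ) x * pd n k (pd n r φ) x))
          + m ^ 2 * (pd n l φ x * pd n k φ x))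
      - gmet n l k *
        ((∑ r, eps n r * (pd n a (pd n r φ) x * pd n b (pd n r φ) x))
          + m ^ 2 * (pd n a φ x * pd n b φ x))
      + (1 / 2 * (if a = b then eps n a else 0) * gmet n l k) *
        ((∑ r, ∑ s, (eps n r * eps n s) * (pd n r (pd n s φ) x * pd n r (pd n s φ) x))
          + (2 * m ^ 2) * (∑ r, eps n r * (pd n r φ x * pd n r φ x))
          + (m ^ 2) ^ 2 * (φ x * φ x)) := by
  funext x
  unfold seSm
  have c4 : ∑ ρ : Fin n, ∑ τ : Fin n, ∑ σ : Fin n, ∑ ν : Fin n,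
            gmet n ρ τ * gmet n σ ν * pd n ρ (pd n σ φ) x * pd n τ (pd n ν φ) x
      = ∑ r, ∑ s, (eps n r * eps n s) * (pd n r (pd n s φ) x * pd n r (pd n s φ) x) := by
    refine Finset.sum_congr rfl fun r _ => ?_
    rw [Finset.sum_eq_single r]
    · refine Finset.sum_congr rfl fun s _ => ?_
      simp [gmet_eq, mul_assoc]
    · intro t _ ht
      simp [gmet_eq, ht.symm]
    · simp
  have c2 : ∀ F G : Fin n → ℝ, ∑ ρ : Fin n, ∑ σ : Fin n, gmet n ρ σ * F ρ * G σ
      = ∑ r, eps n r * (F r * G r) := by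
    intro F G
    simp [gmet_eq, mul_assoc]
  rw [c4, c2 (fun r => pd n l (pd n r φ) x) (fun r => pd n k (pd n r φ) x),
    c2 (fun r => pd n a (pd n r φ) x) (fun r => pd n b (pd n r φ) x),
    c2 (fun r => pd n r φ x) (fun r => pd n r φ x), ← gmet_eq]
  ring

/-- the super-energy tensor field of a smooth solution of the flat
Klein–Gordon equation is divergence-free. -/
theorem seSm_divergence_free
    (n : ℕ) (m : ℝ) (φ : (Fin n → ℝ) → ℝ) (hφ : ContDiff ℝ (⊤ : ℕ∞) φ)
    (hKG : ∀ x : Fin n → ℝ,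
      (∑ μ : Fin n, ∑ ν : Fin n, gmet n μ ν * pd n μ (pd n ν φ) x) = m ^ 2 * φ x) :
    ∀ (x : Fin n → ℝ) (β lam mu : Fin n),
      (∑ ρ : Fin n, ∑ α : Fin n, gmet n ρ α * pd n ρ (seSm n m φ α β lam mu) x) = 0 := by
  intro x b l k
  have sP : ∀ a, ContDiff ℝ (⊤ : ℕ∞) (pd n a φ) := pd_smooth hφ
  have sH : ∀ a c, ContDiff ℝ (⊤ : ℕ∞) (pd n a (pd n c φ)) := fun a c => pd_smooth (sP c) a
  have d0 : Differentiable ℝ φ := hφ.differentiable (by simp)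
  have d1 : ∀ a, Differentiable ℝ (pd n a φ) := fun a => (sP a).differentiable (by simp)
  have d2 : ∀ a c, Differentiable ℝ (pd n a (pd n c φ)) :=
    fun a c => (sH a c).differentiable (by simp)
  have K : ∀ y, ∑ a, eps n a * pd n a (pd n a φ) y = m ^ 2 * φ y := by
    intro y
    rw [← hKG y]
    simp [gmet_eq]
  have K2 : ∀ c, ∑ a, eps n a * pd n c (pd n a (pd n a φ)) x = m ^ 2 * pd n c φ x := by
    intro c
    have h : (fun y => ∑ a, eps n a * pd n a (pd n a φ) y) = fun y => m ^ 2 * φ y := funext K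
    have h' := congrFun (congrArg (pd n c) h) x
    rw [pd_sum' (fun i => (d2 i i).const_mul _), pd_cmul d0] at h'
    rw [← h']
    exact Finset.sum_congr rfl fun a _ => (pd_cmul (d2 a a) _ _ _).symm
  have hc : ∀ F : Fin n → Fin n → ℝ, ∑ ρ, ∑ α, gmet n ρ α * F ρ α = ∑ a, eps n a * F a a := by
    intro F
    simp [gmet_eq]
  rw [hc (fun ρ α => pd n ρ (seSm n m φ α b l k) x)]
  rw [← div_algebra (eps n) (fun a => pd n a φ x) (fun a c => pd n a (pd n c φ) x)
    (fun a c d => pd n a (pd n c (pd n d φ)) x) (m ^ 2) (φ x) (gmet n l k) (eps_sq n)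
    (fun a c => congrFun (pd_comm hφ a c) x) (fun a c d => congrFun (pd_comm (sP d) a c) x)
    (fun a c d => by simp only [pd_comm hφ c d]) (K x) K2 b l k]
  refine Finset.sum_congr rfl fun a _ => ?_
  congr 1
  rw [seSm_eq]
  -- derivative of a product of differentiable functions, times a constant
  have D2 : ∀ (c : ℝ) (i j i' j' : Fin n), Differentiable ℝ
      (fun y => c * (pd n i (pd n j φ) y * pd n i' (pd n j' φ) y)) :=
    fun c i j i' j' => ((d2 i j).fun_mul (d2 i' j')).const_mul c
  have D1 : ∀ (c : ℝ) (i j : Fin n), Differentiable ℝ (fun y => c * (pd n i φ y * pd n j φ y)) :=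
    fun c i j => ((d1 i).fun_mul (d1 j)).const_mul c
  have D0 : Differentiable ℝ (fun y => (m ^ 2) ^ 2 * (φ y * φ y)) := (d0.fun_mul d0).const_mul _
  have S2 : ∀ i j : Fin n, Differentiable ℝ
      (fun y => ∑ r, eps n r * (pd n i (pd n r φ) y * pd n j (pd n r φ) y)) :=
    fun i j => Differentiable.fun_sum fun r _ => D2 _ _ _ _ _
  have S1 : Differentiable ℝ (fun y => ∑ r, eps n r * (pd n r φ y * pd n r φ y)) :=
    Differentiable.fun_sum fun r _ => D1 _ _ _
  have S4' : ∀ r, Differentiable ℝ (fun y => ∑ s, (eps n r * eps n s) *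
      (pd n r (pd n s φ) y * pd n r (pd n s φ) y)) :=
    fun r => Differentiable.fun_sum fun s _ => D2 _ _ _ _ _
  have S4 : Differentiable ℝ (fun y => ∑ r, ∑ s, (eps n r * eps n s) *
      (pd n r (pd n s φ) y * pd n r (pd n s φ) y)) :=
    Differentiable.fun_sum fun r _ => S4' r
  have p2 : ∀ (c : ℝ) (i j i' j' : Fin n),
      pd n a (fun y => c * (pd n i (pd n j φ) y * pd n i' (pd n j' φ) y)) x
      = c * (pd n a (pd n i (pd n j φ)) x * pd n i' (pd n j' φ) x
          + pd n i (pd n j φ) x * pd n a (pd n i' (pd n j' φ)) x) := by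
    intro c i j i' j'
    rw [pd_cmul ((d2 i j).fun_mul (d2 i' j')), pd_mul' (d2 i j) (d2 i' j')]
  have p1 : ∀ (c : ℝ) (i j : Fin n), pd n a (fun y => c * (pd n i φ y * pd n j φ y)) x
      = c * (pd n a (pd n i φ) x * pd n j φ x + pd n i φ x * pd n a (pd n j φ) x) := by
    intro c i j
    rw [pd_cmul ((d1 i).fun_mul (d1 j)), pd_mul' (d1 i) (d1 j)]
  have p0 : pd n a (fun y => (m ^ 2) ^ 2 * (φ y * φ y)) x = (m ^ 2) ^ 2 * (2 * (φ x * pd n a φ x)) := by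
    rw [pd_cmul (d0.fun_mul d0), pd_mul' d0 d0]; ring
  have E1 := (d2 a l).fun_mul (d2 k b)
  have E2 := (d2 a k).fun_mul (d2 l b)
  have E3 := (S2 l k).fun_add (D1 (m ^ 2) l k)
  have E4 := (S2 a b).fun_add (D1 (m ^ 2) a b)
  have E5a := S1.const_mul (2 * m ^ 2)
  have E5 := (S4.fun_add E5a).fun_add D0
  rw [pd_add' (((E1.fun_add E2).fun_sub (E3.const_mul _)).fun_sub (E4.const_mul _)) (E5.const_mul _),
    pd_sub' ((E1.fun_add E2).fun_sub (E3.const_mul _)) (E4.const_mul _),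
    pd_sub' (E1.fun_add E2) (E3.const_mul _), pd_add' E1 E2, pd_mul' (d2 a l) (d2 k b),
    pd_mul' (d2 a k) (d2 l b), pd_cmul E3, pd_cmul E4, pd_cmul E5,
    pd_add' (S2 l k) (D1 _ l k), pd_add' (S2 a b) (D1 _ a b), pd_add' (S4.fun_add E5a) D0,
    pd_add' S4 E5a, pd_cmul S1, pd_sum' (fun r => D2 _ _ _ _ _), pd_sum' (fun r => D2 _ _ _ _ _),
    pd_sum' (fun r => D1 _ _ _), pd_sum' S4', p0]
  have p4 : ∀ r, pd n a (fun y => ∑ s, (eps n r * eps n s) *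
      (pd n r (pd n s φ) y * pd n r (pd n s φ) y)) x = ∑ s, eps n r * eps n s *
        (2 * (pd n r (pd n s φ) x * pd n a (pd n r (pd n s φ)) x)) := by
    intro r
    rw [pd_sum' (fun s => D2 _ _ _ _ _)]
    refine Finset.sum_congr rfl fun s _ => ?_
    rw [p2]; ring
  have p1' : ∀ r, pd n a (fun y => eps n r * (pd n r φ y * pd n r φ y)) x
      = eps n r * (2 * (pd n r φ x * pd n a (pd n r φ) x)) := by
    intro r
    rw [p1]; ring
  simp only [p4, p1', p2, p1]
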